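/- Let d ≥ 1 be an integer, α ∈ ℝ, and u ∈ ℝ^d with u ≠ 0. Then the exact identity ∫_{Δ₂} (t−s)^{−α} p^d_{t−s}(u) ds dt = (2^{α−1} / (π^{d/2} ‖u‖^{2α+d−2})) · ∫_{‖u‖²/2}^{∞} z^{α+d/2−2} (1 − ‖u‖²/(2z)) e^{−z} dz holds. -/

import Mathlib

open MeasureTheory Real

/-- The `d`-dimensional Gaussian density with variance parameter `ε`. -/
noncomputable def gaussD (d : ℕ) (ε : ℝ) (z : EuclideanSpace ℝ (Fin d)) : ℝ :=
  (2 * Real.pi * ε) ^ (-(d : ℝ) / 2) * Real.exp (-‖z‖ ^ 2 / (2 * ε))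

/-- The simplex `Δ₂ = {(s,t) ∈ [0,1]² : s < t}`. -/
def Delta2 : Set (ℝ × ℝ) := {p | 0 ≤ p.1 ∧ p.1 < p.2 ∧ p.2 ≤ 1}

theorem measurableSet_Delta2 : MeasurableSet Delta2 :=
  (measurableSet_le measurable_const measurable_fst).inter
    ((measurableSet_lt measurable_fst measurable_snd).inter
      (measurableSet_le measurable_snd measurable_const))

/-- Integrating a function of `t - s` over the simplex reduces to a weighted integral over
`(0, 1)`. -/
theorem lintegral_Delta2_sub {G : ℝ → ENNReal} (hG : Measurable G) :
    ∫⁻ p in Delta2, G (p.2 - p.1) = ∫⁻ r in Set.Ioo 0 1, ENNReal.ofReal (1 - r) * G r := by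
  have hF : Measurable (Delta2.indicator fun p : ℝ × ℝ => G (p.2 - p.1)) :=
    (hG.comp (measurable_snd.sub measurable_fst)).indicator measurableSet_Delta2
  rw [← lintegral_indicator measurableSet_Delta2, Measure.volume_eq_prod,
    lintegral_prod _ hF.aemeasurable]
  have shift (s : ℝ) : ∫⁻ t, Delta2.indicator (fun p : ℝ × ℝ => G (p.2 - p.1)) (s, t)
      = ∫⁻ r, Delta2.indicator (fun p : ℝ × ℝ => G (p.2 - p.1)) (s, r + s) :=
    (lintegral_add_right_eq_self _ s).symm
  simp_rw [shift]
  have hF' : Measurable (Function.uncurry fun s r : ℝ =>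
      Delta2.indicator (fun p : ℝ × ℝ => G (p.2 - p.1)) (s, r + s)) :=
    hF.comp (measurable_fst.prodMk (measurable_snd.add measurable_fst))
  rw [lintegral_lintegral_swap hF'.aemeasurable, ← lintegral_indicator measurableSet_Ioo]
  congr 1 with r
  by_cases hr : r ∈ Set.Ioo (0 : ℝ) 1
  · have slice (s : ℝ) : Delta2.indicator (fun p : ℝ × ℝ => G (p.2 - p.1)) (s, r + s)
        = (Set.Icc 0 (1 - r)).indicator (fun _ => G r) s := by
      have hiff : (s, r + s) ∈ Delta2 ↔ s ∈ Set.Icc 0 (1 - r) := by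
        constructor
        · rintro ⟨h₁, -, h₃⟩
          exact ⟨h₁, by dsimp only at h₃; linarith⟩
        · rintro ⟨h₁, h₂⟩
          exact ⟨h₁, by dsimp only; linarith [hr.1], by dsimp only; linarith⟩
      by_cases hs : s ∈ Set.Icc 0 (1 - r)
      · rw [Set.indicator_of_mem (hiff.2 hs), Set.indicator_of_mem hs, add_sub_cancel_right]
      · rw [Set.indicator_of_notMem (mt hiff.1 hs), Set.indicator_of_notMem hs]
    simp_rw [slice]
    rw [lintegral_indicator measurableSet_Icc, setLIntegral_const, Real.volume_Icc,
      Set.indicator_of_mem hr, sub_zero, mul_comm]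
  · rw [Set.indicator_of_notMem hr]
    refine (lintegral_congr_ae ?_).trans lintegral_zero
    filter_upwards [Measure.ae_ne volume (0 : ℝ)] with s hs
    refine Set.indicator_of_notMem (fun h => hr ?_) _
    obtain ⟨h₁, h₂, h₃⟩ := h
    dsimp only at h₁ h₂ h₃
    have : 0 < s := lt_of_le_of_ne h₁ (Ne.symm hs)
    exact ⟨by linarith, by linarith⟩

theorem integral_Delta2_sub {g : ℝ → ℝ} (hg : Measurable g) (hg₀ : ∀ r, 0 < r → 0 ≤ g r) :
    ∫ p in Delta2, g (p.2 - p.1) = ∫ r in Set.Ioo 0 1, (1 - r) * g r := by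
  rw [integral_eq_lintegral_of_nonneg_ae, integral_eq_lintegral_of_nonneg_ae,
    lintegral_Delta2_sub hg.ennreal_ofReal]
  · congr 1
    refine setLIntegral_congr_fun measurableSet_Ioo fun r hr => ?_
    exact (ENNReal.ofReal_mul (by linarith [hr.2])).symm
  · refine (ae_restrict_iff' measurableSet_Ioo).2 (.of_forall fun r hr => ?_)
    exact mul_nonneg (by linarith [hr.2]) (hg₀ r hr.1)
  · exact ((measurable_const.sub measurable_id).mul hg).aestronglyMeasurable
  · refine (ae_restrict_iff' measurableSet_Delta2).2 (.of_forall fun p hp => ?_)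
    exact hg₀ _ (sub_pos.2 hp.2.1)
  · exact (hg.comp (measurable_snd.sub measurable_fst)).aestronglyMeasurable

/-- The substitution `r = c / z`. -/
theorem integral_Ioo_zero_one_eq_integral_Ioi_div {c : ℝ} (hc : 0 < c) (f : ℝ → ℝ) :
    ∫ r in Set.Ioo 0 1, f r = ∫ z in Set.Ioi c, c / z ^ 2 * f (c / z) := by
  have himage : (fun z => c / z) '' Set.Ioi c = Set.Ioo 0 1 := by
    ext r
    constructor
    · rintro ⟨z, hz, rfl⟩
      have hz₀ : 0 < z := hc.trans hz
      exact ⟨div_pos hc hz₀, (div_lt_one hz₀).2 hz⟩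
    · rintro ⟨h₀, h₁⟩
      exact ⟨c / r, (lt_div_iff₀ h₀).2 (by nlinarith), by field_simp⟩
  have hderiv (z : ℝ) (hz : z ∈ Set.Ioi c) :
      HasDerivWithinAt (fun z => c / z) (-(c / z ^ 2)) (Set.Ioi c) z := by
    have hz₀ : z ≠ 0 := (hc.trans hz).ne'
    simpa only [div_eq_mul_inv, mul_neg, Pi.inv_apply] using
      ((hasDerivAt_inv hz₀).const_mul c).hasDerivWithinAt (s := Set.Ioi c)
  have hinj : Set.InjOn (fun z => c / z) (Set.Ioi c) := fun x hx y hy h => by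
    have hx₀ : x ≠ 0 := (hc.trans hx).ne'
    have hy₀ : y ≠ 0 := (hc.trans hy).ne'
    have h' : c / x = c / y := h
    rw [div_eq_div_iff hx₀ hy₀] at h'
    exact (mul_left_cancel₀ hc.ne' h').symm
  rw [← himage, integral_image_eq_integral_abs_deriv_smul measurableSet_Ioi hderiv hinj]
  refine setIntegral_congr_fun measurableSet_Ioi fun z _ => ?_
  simp only [abs_neg, smul_eq_mul]
  rw [abs_of_nonneg (by positivity)]

theorem stmt2 (d : ℕ) (hd : 1 ≤ d) (α : ℝ) (u : EuclideanSpace ℝ (Fin d)) (hu : u ≠ 0) :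
    ∫ p in Delta2, (p.2 - p.1) ^ (-α) * gaussD d (p.2 - p.1) u
      = (2 : ℝ) ^ (α - 1) / (Real.pi ^ ((d : ℝ) / 2) * ‖u‖ ^ (2 * α + d - 2)) *
        ∫ z in Set.Ioi (‖u‖ ^ 2 / 2),
          z ^ (α + d / 2 - 2) * (1 - ‖u‖ ^ 2 / (2 * z)) * Real.exp (-z) := by
  have ha : 0 < ‖u‖ := norm_pos_iff.2 hu
  have hc : 0 < ‖u‖ ^ 2 / 2 := by positivity
  have hmeas : Measurable fun r : ℝ => r ^ (-α) * gaussD d r u := by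
    unfold gaussD
    fun_prop
  have hnonneg (r : ℝ) (hr : 0 < r) : 0 ≤ r ^ (-α) * gaussD d r u := by
    unfold gaussD
    positivity
  rw [integral_Delta2_sub hmeas hnonneg, integral_Ioo_zero_one_eq_integral_Ioi_div hc,
    ← integral_const_mul]
  refine setIntegral_congr_fun measurableSet_Ioi fun z hz => ?_
  have hz₀ : 0 < z := hc.trans hz
  have hexp : -‖u‖ ^ 2 / (2 * (‖u‖ ^ 2 / 2 / z)) = -z := by field_simp
  have hone : ‖u‖ ^ 2 / 2 / z = ‖u‖ ^ 2 / (2 * z) := by field_simp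
  have hpow : ‖u‖ ^ 2 / 2 / z ^ 2 * ((‖u‖ ^ 2 / 2 / z) ^ (-α) *
        (2 * π * (‖u‖ ^ 2 / 2 / z)) ^ (-(d : ℝ) / 2))
      = 2 ^ (α - 1) / (π ^ ((d : ℝ) / 2) * ‖u‖ ^ (2 * α + d - 2)) * z ^ (α + d / 2 - 2) := by
    have hπ := Real.pi_pos
    refine Real.log_injOn_pos (Set.mem_Ioi.2 (by positivity)) (Set.mem_Ioi.2 (by positivity)) ?_
    have h₁ : 0 < ‖u‖ ^ 2 / 2 / z := by positivity
    rw [Real.log_mul (by positivity) (by positivity), Real.log_mul (by positivity) (by positivity),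
      Real.log_mul (by positivity) (by positivity), Real.log_div (by positivity) (by positivity),
      Real.log_div (by positivity) (by positivity), Real.log_div (by positivity) (by positivity),
      Real.log_mul (by positivity) (by positivity), Real.log_rpow h₁, Real.log_rpow (by positivity), Real.log_rpow two_pos, Real.log_rpow hπ,
      Real.log_rpow ha, Real.log_rpow hz₀, Real.log_mul (by positivity) (by positivity),
      Real.log_mul two_ne_zero hπ.ne', Real.log_div (by positivity) (by positivity),
      Real.log_div (by positivity) (by positivity), Real.log_pow, Real.log_pow]
    push_cast
    ring
  simp only [gaussD]
  rw [hexp]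
  calc _ = (‖u‖ ^ 2 / 2 / z ^ 2 * ((‖u‖ ^ 2 / 2 / z) ^ (-α) *
        (2 * π * (‖u‖ ^ 2 / 2 / z)) ^ (-(d : ℝ) / 2))) *
          ((1 - ‖u‖ ^ 2 / 2 / z) * Real.exp (-z)) := by ring
    _ = _ := by rw [hpow, hone]; ring
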